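/- arXiv:1510.07424 — 3 statements merged into one kernel-verified Lean document; each statement's English description precedes it below -/
import Mathlib

section
/- Let R be the 4-agent profile over A = {a,b,c,d}: ≽_1: {a,c},b,d; ≽_2: {b,d},a,c; ≽_3: a,d,b,c; ≽_4: b,c,a,d. Then no alternative in A is Pareto-dominated in R (so the uniform lottery 1/4 a + 1/4 b + 1/4 c + 1/4 d is ex post efficient), yet the uniform lottery is not sd-efficient for R: every agent i satisfies (1/2 a + 1/2 b) ≻_i^sd (1/4 a + 1/4 b + 1/4 c + 1/4 d). -/
open Finset
open scoped Classical

section Framework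

variable {A : Type*} [Fintype A] {n : ℕ}

/-- `p` is a lottery (probability distribution) on the set of alternatives `A`. -/
def IsLottery (p : A → ℝ) : Prop := (∀ x, 0 ≤ p x) ∧ ∑ x, p x = 1

/-- `r` is a weak preference relation: complete (total) and transitive. -/
def IsPref (r : A → A → Prop) : Prop := Total r ∧ Transitive r

/-- A preference profile assigns a weak preference relation to each of the `n` agents. -/
def IsProfile (R : Fin n → A → A → Prop) : Prop := ∀ i, IsPref (R i)

/-- The probability that `p` assigns to alternatives weakly preferred (by `r`) to `x`. -/
noncomputable def upperProb (r : A → A → Prop) (p : A → ℝ) (x : A) : ℝ :=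
  ∑ y ∈ univ.filter (fun y => r y x), p y

/-- Stochastic dominance: `p ≽^sd q` w.r.t. the preference relation `r`. -/
def SDge (r : A → A → Prop) (p q : A → ℝ) : Prop :=
  ∀ x, upperProb r q x ≤ upperProb r p x

/-- Strict stochastic dominance: `p ≻^sd q` w.r.t. the preference relation `r`. -/
def SDgt (r : A → A → Prop) (p q : A → ℝ) : Prop :=
  SDge r p q ∧ ¬ SDge r q p

/-- A social decision scheme maps every preference profile to a lottery. -/
def IsSDS (f : (Fin n → A → A → Prop) → (A → ℝ)) : Prop :=
  ∀ R : Fin n → A → A → Prop, IsProfile R → IsLottery (f R)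

/-- Anonymity: invariance under permutations of the agents. -/
def Anonymous (f : (Fin n → A → A → Prop) → (A → ℝ)) : Prop :=
  ∀ R : Fin n → A → A → Prop, IsProfile R → ∀ π : Equiv.Perm (Fin n),
    f (fun i => R (π i)) = f R

/-- Neutrality: `f(R^σ)(σ x) = f(R)(x)`, where `R^σ` relabels alternatives by `σ`
(i.e. `σ x ≽^σ_i σ y ↔ x ≽_i y`). -/
def Neutral (f : (Fin n → A → A → Prop) → (A → ℝ)) : Prop :=
  ∀ R : Fin n → A → A → Prop, IsProfile R → ∀ σ : Equiv.Perm A, ∀ x : A,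
    f (fun i u v => R i (σ.symm u) (σ.symm v)) (σ x) = f R x

/-- The lottery `p` is sd-efficient for the profile `R`: no lottery `q` is weakly
sd-preferred to `p` by all agents and strictly sd-preferred by some agent. -/
def SDEfficientLottery (R : Fin n → A → A → Prop) (p : A → ℝ) : Prop :=
  ¬ ∃ q : A → ℝ, IsLottery q ∧ (∀ i, SDge (R i) q p) ∧ (∃ i, SDgt (R i) q p)

/-- sd-efficiency of a social decision scheme. -/
def SDEfficient (f : (Fin n → A → A → Prop) → (A → ℝ)) : Prop :=
  ∀ R : Fin n → A → A → Prop, IsProfile R → SDEfficientLottery R (f R)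

/-- sd-strategyproofness: no agent can misreport and obtain a strictly
sd-preferred lottery. -/
def SDStrategyproof (f : (Fin n → A → A → Prop) → (A → ℝ)) : Prop :=
  ∀ R R' : Fin n → A → A → Prop, IsProfile R → IsProfile R' → ∀ i : Fin n,
    (∀ j, j ≠ i → R j = R' j) → ¬ SDgt (R i) (f R') (f R)

/-- `x` is the unique most-preferred alternative of the relation `r`. -/
def UniqueTop (r : A → A → Prop) (x : A) : Prop :=
  ∀ y, y ≠ x → r x y ∧ ¬ r y x

/-- `f` extends random dictatorship: whenever every agent has a unique top choice,
each alternative gets probability (number of agents having it as top)/n. -/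
def ExtendsRD (f : (Fin n → A → A → Prop) → (A → ℝ)) : Prop :=
  ∀ R : Fin n → A → A → Prop, IsProfile R →
    ∀ t : Fin n → A, (∀ i, UniqueTop (R i) (t i)) →
      ∀ x : A, f R x = ((univ.filter (fun i => t i = x)).card : ℝ) / (n : ℝ)

/-- `x` is Pareto-dominated in the profile `R`. -/
def Pareto_Dominated (R : Fin n → A → A → Prop) (x : A) : Prop :=
  ∃ y : A, (∀ i, R i y x) ∧ ∃ i, R i y x ∧ ¬ R i x y

end Framework

/-! Concrete setting: alternatives `A = {a,b,c,d}` encoded as `Fin 4`. -/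

/-- The alternative `a`. -/ def a : Fin 4 := 0
/-- The alternative `b`. -/ def b : Fin 4 := 1
/-- The alternative `c`. -/ def c : Fin 4 := 2
/-- The alternative `d`. -/ def d : Fin 4 := 3

/-- The weak preference relation induced by a rank function over `(a,b,c,d)`
(lower rank = more preferred; equal ranks = indifference). -/
def pr (rk : Fin 4 → ℕ) : Fin 4 → Fin 4 → Prop := fun x y => rk x ≤ rk y

/-- The profile `R`: ≽₁: {a,c},b,d; ≽₂: {b,d},a,c; ≽₃: a,d,b,c; ≽₄: b,c,a,d. -/
def R : Fin 4 → Fin 4 → Fin 4 → Prop :=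
  ![pr ![0,1,0,2], pr ![1,0,2,0], pr ![0,2,3,1], pr ![2,0,1,3]]

theorem not_paretoDominated_R (x : Fin 4) : ¬ Pareto_Dominated R x := by
  rintro ⟨y, hy, i, -, hi⟩
  have h₀ := hy 0
  have h₁ := hy 1
  have h₂ := hy 2
  have h₃ := hy 3
  fin_cases x <;> fin_cases y <;> simp [R, pr] at h₀ h₁ h₂ h₃ <;>
    fin_cases i <;> simp [R, pr] at hi

theorem sdgt_R_half_quarter (i : Fin 4) :
    SDgt (R i) ![1/2, 1/2, 0, 0] ![1/4, 1/4, 1/4, 1/4] := by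
  refine ⟨fun x => ?_, fun h => ?_⟩
  · fin_cases i <;> fin_cases x <;>
      simp [upperProb, Finset.sum_filter, Fin.sum_univ_four, R, pr] <;> norm_num
  · have h₀ := h 0
    have h₁ := h 1
    fin_cases i <;>
      simp [upperProb, Finset.sum_filter, Fin.sum_univ_four, R, pr] at h₀ h₁ <;> linarith

/-- In the profile `R`, no alternative is Pareto-dominated (hence the uniform lottery
`1/4 a + 1/4 b + 1/4 c + 1/4 d` is ex post efficient), yet the uniform lottery is not
sd-efficient: every agent strictly sd-prefers `1/2 a + 1/2 b` to it. -/
theorem uniform_ex_post_but_not_sd_efficient :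
    (∀ x : Fin 4, ¬ Pareto_Dominated R x) ∧
    (∀ x : Fin 4, Pareto_Dominated R x → (![1/4, 1/4, 1/4, 1/4] : Fin 4 → ℝ) x = 0) ∧
    (∀ i : Fin 4, SDgt (R i) ![1/2, 1/2, 0, 0] ![1/4, 1/4, 1/4, 1/4]) ∧
    ¬ SDEfficientLottery R ![1/4, 1/4, 1/4, 1/4] := by
  refine ⟨not_paretoDominated_R, fun x hx => absurd hx (not_paretoDominated_R x),
    sdgt_R_half_quarter, fun h => h ⟨![1/2, 1/2, 0, 0], ⟨fun x => ?_, ?_⟩,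
      fun i => (sdgt_R_half_quarter i).1, 0, sdgt_R_half_quarter 0⟩⟩
  · fin_cases x <;> norm_num
  · simp [Fin.sum_univ_four]; norm_num
end

section
/- Let R be a profile of complete transitive preference relations of n agents over a finite set A, and let p be a lottery on A such that every alternative in the support of p is the unique most-preferred alternative of some agent (i.e., for every x with p(x) > 0 there exists an agent i with x ≻_i y for all y ∈ A ∖ {x}). Then p is sd-efficient for R. -/
open Finset
open scoped Classical

/-- An alternative that is uniquely top-ranked is alone in its own upper contour set. -/
theorem upperProb_of_uniqueTop {A : Type*} [Fintype A] {r : A → A → Prop} (hr : IsPref r)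
    {x : A} (hx : UniqueTop r x) (p : A → ℝ) : upperProb r p x = p x := by
  have hxx : r x x := (hr.1 x x).elim id id
  have hset : univ.filter (fun y => r y x) = {x} := by
    ext y
    simp only [mem_filter, mem_univ, true_and, mem_singleton]
    refine ⟨fun h => ?_, fun h => h ▸ hxx⟩
    by_contra hne
    exact (hx y hne).2 h
  rw [upperProb, hset, sum_singleton]

/-- Every lottery that randomizes only over alternatives that are uniquely top-ranked
by some agent is sd-efficient. -/
theorem support_of_unique_tops_sd_efficient {A : Type*} [Fintype A] {n : ℕ}
    (R : Fin n → A → A → Prop) (hR : IsProfile R)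
    (p : A → ℝ) (hp : IsLottery p)
    (htop : ∀ x : A, 0 < p x → ∃ i : Fin n, UniqueTop (R i) x) :
    SDEfficientLottery R p := by
  rintro ⟨q, hq, hge, i, -, hnot⟩
  have hle : ∀ x ∈ (univ : Finset A), p x ≤ q x := fun x _ => by
    rcases (hp.1 x).eq_or_lt with h0 | hpos
    · exact h0 ▸ hq.1 x
    · obtain ⟨j, hj⟩ := htop x hpos
      simpa only [upperProb_of_uniqueTop (hR j) hj] using hge j x
  have heq : p = q := funext fun x =>
    (sum_eq_sum_iff_of_le hle).1 (hp.2.trans hq.2.symm) x (mem_univ x)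
  exact hnot fun x => heq ▸ le_rfl
end

section
/- Let R be a profile of complete transitive preference relations of n agents over a finite set A, and let p be a lottery on A that is sd-efficient for R. Then p assigns probability zero to every Pareto-dominated alternative; that is, sd-efficiency implies ex post efficiency. -/
open Finset
open scoped Classical

/-- The lottery obtained from `p` by moving all probability of `x` to `y`. -/
noncomputable def shiftMass {A : Type*} (p : A → ℝ) (x y : A) (z : A) : ℝ :=
  p z + ((if z = y then p x else 0) - (if z = x then p x else 0))

lemma isLottery_shiftMass {A : Type*} [Fintype A] {p : A → ℝ} (hp : IsLottery p) (x y : A) :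
    IsLottery (shiftMass p x y) := by
  refine ⟨fun z => ?_, ?_⟩
  · have hz := hp.1 z
    have hx := hp.1 x
    unfold shiftMass
    split_ifs <;> subst_vars <;> linarith
  · simp [shiftMass, sum_add_distrib, hp.2]

lemma upperProb_shiftMass {A : Type*} [Fintype A] (r : A → A → Prop) (p : A → ℝ) (x y z : A) :
    upperProb r (shiftMass p x y) z =
      upperProb r p z + ((if r y z then p x else 0) - (if r x z then p x else 0)) := by
  simp [upperProb, shiftMass, sum_add_distrib, sum_ite_eq']

lemma sdGe_shiftMass {A : Type*} [Fintype A] {r : A → A → Prop} (hr : IsPref r)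
    {p : A → ℝ} {x y : A} (hx : 0 ≤ p x) (hyx : r y x) : SDge r (shiftMass p x y) p := by
  intro z
  rw [upperProb_shiftMass]
  by_cases hxz : r x z
  · simp [hxz, hr.2 hyx hxz]
  · by_cases hyz : r y z <;> simp [hxz, hyz, hx]

lemma not_sdGe_shiftMass {A : Type*} [Fintype A] {r : A → A → Prop} (hr : IsPref r)
    {p : A → ℝ} {x y : A} (hx : 0 < p x) (hxy : ¬ r x y) : ¬ SDge r p (shiftMass p x y) := by
  intro h
  have hyy := h y
  rw [upperProb_shiftMass, if_pos ((hr.1 y y).elim id id), if_neg hxy] at hyy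
  linarith

/-- sd-efficiency implies ex post efficiency: an sd-efficient lottery assigns
probability zero to every Pareto-dominated alternative. -/
theorem sd_efficient_implies_ex_post_efficient {A : Type*} [Fintype A] {n : ℕ}
    (R : Fin n → A → A → Prop) (hR : IsProfile R)
    (p : A → ℝ) (hp : IsLottery p) (heff : SDEfficientLottery R p) :
    ∀ x : A, Pareto_Dominated R x → p x = 0 := by
  rintro x ⟨y, hyx, i, -, hxy⟩
  by_contra hne
  have hpos : 0 < p x := lt_of_le_of_ne (hp.1 x) (Ne.symm hne)
  have hge : ∀ j, SDge (R j) (shiftMass p x y) p :=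
    fun j => sdGe_shiftMass (hR j) hpos.le (hyx j)
  exact heff ⟨shiftMass p x y, isLottery_shiftMass hp x y, hge,
    i, hge i, not_sdGe_shiftMass (hR i) hpos hxy⟩
end
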